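/- For all k, m ∈ ℕ with m odd, sup_{0 ≤ x ≤ 1} |φ_0^{k,m}(x) − φ_0(x)| ≤ 4^{−k}·ζ(2k+4)/(π·μ·(2k+4)^4) + 2·e^{−(m+2)π}/(μ·(m+2)^4). In particular, sup_{0 ≤ x ≤ 1} |φ_0^{9,5}(x) − φ_0(x)| < 10^{−10}. -/

import Mathlib

/-- `a n = (4/n^4)·tanh(nπ/2) − π/n^3`. -/
noncomputable def a (n : ℕ) : ℝ :=
  4 / (n : ℝ) ^ 4 * Real.tanh ((n : ℝ) * Real.pi / 2) - Real.pi / (n : ℝ) ^ 3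

/-- `d n = 1 − tanh(nπ/2)`. -/
noncomputable def d (n : ℕ) : ℝ := 1 - Real.tanh ((n : ℝ) * Real.pi / 2)

/-- `ψ(z) = (24/π^4) · Σ_{n odd} a_n · sin(nπz)`, the sum over odd positive integers. -/
noncomputable def psi (z : ℝ) : ℝ :=
  (24 / Real.pi ^ 4) * ∑' k : ℕ, a (2 * k + 1) * Real.sin ((2 * (k : ℝ) + 1) * Real.pi * z)

/-- `μ = (48/π^4) Σ_{n odd} sech²(nπ/2)/n^4`. -/
noncomputable def mu : ℝ :=
  (48 / Real.pi ^ 4) *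
    ∑' k : ℕ, (1 / Real.cosh ((2 * (k : ℝ) + 1) * Real.pi / 2)) ^ 2 / (2 * (k : ℝ) + 1) ^ 4

/-- The splitting density `φ_0 = ψ/μ`. -/
noncomputable def phi0 (z : ℝ) : ℝ := psi z / mu

/-- `ζ(s) = Σ_{n≥1} n^{−s}` (for natural `s`, as a real series). -/
noncomputable def zetaR (s : ℕ) : ℝ := ∑' n : ℕ, 1 / ((n : ℝ) + 1) ^ s

/-- `|B(2ℓ)| = 2·ζ(2ℓ)·(2ℓ)!/(2π)^{2ℓ}`. -/
noncomputable def Babs (l : ℕ) : ℝ :=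
  2 * zetaR (2 * l) * (Nat.factorial (2 * l)) / (2 * Real.pi) ^ (2 * l)

/-- The approximant `ψ^{k,m}`.  (Note `Real.log 0 = 0`, which implements the convention
`x^3·log(πx) = 0` at `x = 0`.)  The final sum runs over odd `n ≤ m`. -/
noncomputable def psikm (k m : ℕ) (x : ℝ) : ℝ :=
  (84 / Real.pi ^ 3) * x * zetaR 3 + (8 / Real.pi) * x ^ 3 * Real.log (Real.pi * x)
    - (8 / Real.pi) * (11 / 6 + Real.log 2) * x ^ 3 - 3 * x * (1 - x)
    + 48 * Real.pi * x ^ 5 *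
        ∑ n ∈ Finset.range (k + 1),
          Babs (n + 1) * (2 ^ (2 * n + 1) - 1) * Real.pi ^ (2 * n) * x ^ (2 * n)
            / (((n : ℝ) + 1) * (Nat.factorial (2 * n + 5)))
    - (96 / Real.pi ^ 4) *
        ∑ i ∈ Finset.range ((m + 1) / 2),
          (d (2 * i + 1) / (2 * (i : ℝ) + 1) ^ 4)
            * Real.sin ((2 * (i : ℝ) + 1) * Real.pi * x)

/-- The symmetrized approximant `φ_0^{k,m}`. -/
noncomputable def phi0km (k m : ℕ) (x : ℝ) : ℝ :=
  if x ≤ 1 / 2 then psikm k m x / mu else psikm k m (1 - x) / mu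


/-! ### Auxiliary series -/

noncomputable def auxF (j : ℕ) (z : ℂ) : ℂ :=
  ∑' k : ℕ, Complex.exp (Complex.I * Real.pi * (2 * k + 1) * z) / (2 * k + 1) ^ j

noncomputable def auxBeta (n : ℕ) : ℝ := zetaR (2 * n + 2) * (1 - 1 / 2 ^ (2 * n + 1))

noncomputable def auxGamma (j n : ℕ) : ℝ :=
  auxBeta n * (Nat.factorial (2 * n + 1)) / (Nat.factorial (2 * n + 1 + j))

noncomputable def auxQ (j : ℕ) (z : ℂ) : ℂ :=
  ∑' n : ℕ, (auxGamma j n : ℂ) * z ^ (2 * n + 1 + j)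

lemma zetaR_summable {s : ℕ} (hs : 2 ≤ s) : Summable (fun n : ℕ => 1 / ((n : ℝ) + 1) ^ s) := by
  have := (summable_nat_add_iff 1).2 (Real.summable_one_div_nat_pow.2 (show 1 < s by omega))
  simpa using this

lemma zetaR_nonneg (s : ℕ) : 0 ≤ zetaR s := tsum_nonneg fun n => by positivity

lemma zetaR_anti {s t : ℕ} (hs : 2 ≤ s) (hst : s ≤ t) : zetaR t ≤ zetaR s := by
  refine (zetaR_summable (hs.trans hst)).tsum_le_tsum (fun n => ?_) (zetaR_summable hs)
  apply one_div_le_one_div_of_le (by positivity)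
  exact pow_le_pow_right₀ (by linarith [(Nat.cast_nonneg n : (0:ℝ) ≤ n)]) hst

lemma auxBeta_nonneg (n : ℕ) : 0 ≤ auxBeta n := by
  refine mul_nonneg (zetaR_nonneg _) ?_
  rw [sub_nonneg, div_le_one (by positivity)]
  exact one_le_pow₀ (by norm_num)

lemma auxBeta_le (n : ℕ) : auxBeta n ≤ zetaR (2 * n + 2) := by
  refine mul_le_of_le_one_right (zetaR_nonneg _) ?_
  have : (0:ℝ) ≤ 1 / 2 ^ (2 * n + 1) := by positivity
  linarith

lemma auxGamma_nonneg (j n : ℕ) : 0 ≤ auxGamma j n := by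
  have := auxBeta_nonneg n
  unfold auxGamma; positivity

lemma auxGamma_le (j n : ℕ) : auxGamma j n ≤ zetaR 2 := by
  unfold auxGamma
  rw [div_le_iff₀ (by positivity)]
  have h1 : auxBeta n ≤ zetaR 2 := (auxBeta_le n).trans (zetaR_anti le_rfl (by omega))
  have h2 : ((Nat.factorial (2 * n + 1) : ℕ) : ℝ) ≤ (Nat.factorial (2 * n + 1 + j) : ℕ) := by
    exact_mod_cast Nat.factorial_le (by omega)
  exact mul_le_mul h1 h2 (by positivity) (zetaR_nonneg _)

lemma auxGamma_succ (j n : ℕ) :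
    auxGamma (j + 1) n * (2 * n + 1 + (j + 1) : ℕ) = auxGamma j n := by
  unfold auxGamma
  rw [show 2 * n + 1 + (j + 1) = (2 * n + 1 + j) + 1 by ring]
  have : (Nat.factorial (2 * n + 1 + j) : ℝ) ≠ 0 := by positivity
  have : (((2 * n + 1 + j : ℕ) + 1 : ℕ) : ℝ) ≠ 0 := by positivity
  rw [Nat.factorial_succ (2 * n + 1 + j)]
  push_cast at *
  field_simp

lemma auxQ_term_bound (j n : ℕ) {r : ℝ} (hr0 : 0 ≤ r) (hr : r ≤ 1) (z : ℂ) (hz : ‖z‖ ≤ r) :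
    ‖(auxGamma j n : ℂ) * z ^ (2 * n + 1 + j)‖ ≤ zetaR 2 * (r ^ 2) ^ n := by
  rw [norm_mul, norm_pow, Complex.norm_real, Real.norm_of_nonneg (auxGamma_nonneg j n)]
  refine mul_le_mul (auxGamma_le j n) ?_ (by positivity) (zetaR_nonneg _)
  calc ‖z‖ ^ (2 * n + 1 + j) ≤ r ^ (2 * n + 1 + j) := pow_le_pow_left₀ (norm_nonneg _) hz _
    _ ≤ r ^ (2 * n) := pow_le_pow_of_le_one hr0 hr (by omega)
    _ = _ := by rw [pow_mul]

lemma auxQ_bound_summable {r : ℝ} (hr0 : 0 ≤ r) (hr : r < 1) :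
    Summable (fun n : ℕ => zetaR 2 * (r ^ 2) ^ n) :=
  (summable_geometric_of_lt_one (by positivity) (by nlinarith)).mul_left _

lemma auxQ_summable (j : ℕ) {z : ℂ} (hz : ‖z‖ < 1) :
    Summable (fun n : ℕ => (auxGamma j n : ℂ) * z ^ (2 * n + 1 + j)) :=
  .of_norm_bounded (auxQ_bound_summable (norm_nonneg z) hz)
    fun n => auxQ_term_bound j n (norm_nonneg z) hz.le z le_rfl

lemma auxQ_hasDerivAt (j : ℕ) {z : ℂ} (hz : ‖z‖ < 1) :
    HasDerivAt (auxQ (j + 1)) (auxQ j z) z := by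
  obtain ⟨r, hr1, hr2⟩ := exists_between hz
  have hr0 : 0 ≤ r := (norm_nonneg z).trans hr1.le
  show HasDerivAt (fun z : ℂ => ∑' n : ℕ, (auxGamma (j + 1) n : ℂ) * z ^ (2 * n + 1 + (j + 1)))
    (∑' n : ℕ, (auxGamma j n : ℂ) * z ^ (2 * n + 1 + j)) z
  refine hasDerivAt_tsum_of_isPreconnected (t := Metric.ball (0:ℂ) r) (y₀ := z)
    (g := fun (n : ℕ) (z : ℂ) => (auxGamma (j + 1) n : ℂ) * z ^ (2 * n + 1 + (j + 1)))
    (g' := fun (n : ℕ) (z : ℂ) => (auxGamma j n : ℂ) * z ^ (2 * n + 1 + j))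
    (auxQ_bound_summable hr0 hr2)
    Metric.isOpen_ball (convex_ball _ _).isPreconnected ?_ ?_ (by simpa using hr1)
    (auxQ_summable _ hz) (by simpa using hr1)
  · intro n y hy
    have h := ((hasDerivAt_pow (2 * n + 1 + (j + 1)) y).const_mul ((auxGamma (j + 1) n : ℝ) : ℂ))
    refine h.congr_deriv ?_
    rw [← auxGamma_succ j n]
    push_cast
    rw [show 2 * n + 1 + (j + 1) - 1 = 2 * n + 1 + j by omega]
    ring
  · intro n y hy
    exact auxQ_term_bound j n hr0 hr2.le y (by simpa using (Metric.mem_ball.1 hy).le)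

lemma auxQ_zero (j : ℕ) : auxQ j 0 = 0 := by
  unfold auxQ
  simp

lemma auxQ_continuousAt (j : ℕ) {z : ℂ} (hz : ‖z‖ < 1) : ContinuousAt (auxQ (j + 1)) z :=
  (auxQ_hasDerivAt j hz).continuousAt

lemma auxF_norm (k : ℕ) (z : ℂ) :
    ‖Complex.exp (Complex.I * Real.pi * (2 * k + 1) * z)‖
      = Real.exp (-(Real.pi * (2 * k + 1) * z.im)) := by
  rw [Complex.norm_exp]
  congr 1
  simp [Complex.mul_re, Complex.mul_im]

lemma auxOdd_norm (k : ℕ) : ‖(2 * (k : ℂ) + 1)‖ = 2 * (k : ℝ) + 1 := by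
  have : (2 * (k : ℂ) + 1) = ((2 * (k : ℝ) + 1 : ℝ) : ℂ) := by push_cast; ring
  rw [this, Complex.norm_real, Real.norm_of_nonneg (by positivity)]

lemma auxF_term_bound (j k : ℕ) {δ : ℝ} (z : ℂ) (hz : δ ≤ z.im) (hδ : 0 ≤ δ) :
    ‖Complex.exp (Complex.I * Real.pi * (2 * k + 1) * z) / (2 * k + 1) ^ j‖
      ≤ (Real.exp (-(Real.pi * δ))) ^ k := by
  rw [norm_div, norm_pow, auxOdd_norm, auxF_norm, ← Real.exp_nat_mul]
  refine (div_le_self (Real.exp_pos _).le (one_le_pow₀ (by linarith [(Nat.cast_nonneg k : (0:ℝ) ≤ k)]))).trans ?_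
  apply Real.exp_le_exp.2
  have h1 : (k:ℝ) * (Real.pi * δ) ≤ (2 * k + 1) * (Real.pi * z.im) := by
    apply mul_le_mul
    · linarith [(Nat.cast_nonneg k : (0:ℝ) ≤ k)]
    · exact mul_le_mul_of_nonneg_left hz Real.pi_pos.le
    · have := Real.pi_pos; positivity
    · positivity
  nlinarith

lemma auxF_bound_summable {δ : ℝ} (hδ : 0 < δ) :
    Summable (fun k : ℕ => (Real.exp (-(Real.pi * δ))) ^ k) :=
  summable_geometric_of_lt_one (Real.exp_pos _).le
    (Real.exp_lt_one_iff.2 (by have := Real.pi_pos; nlinarith [mul_pos this hδ]))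

lemma auxF_summable (j : ℕ) {z : ℂ} (hz : 0 < z.im) :
    Summable (fun k : ℕ => Complex.exp (Complex.I * Real.pi * (2 * k + 1) * z) / (2 * k + 1) ^ j) :=
  .of_norm_bounded (auxF_bound_summable hz) fun k => auxF_term_bound j k z le_rfl hz.le

lemma auxF_hasDerivAt (j : ℕ) {z : ℂ} (hz : 0 < z.im) :
    HasDerivAt (auxF (j + 1)) (Complex.I * Real.pi * auxF j z) z := by
  obtain ⟨δ, h0, h1⟩ := exists_between hz
  have e : Complex.I * Real.pi * auxF j z = ∑' k : ℕ, Complex.I * Real.pi *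
      (Complex.exp (Complex.I * Real.pi * (2 * k + 1) * z) / (2 * k + 1) ^ j) := by
    unfold auxF
    rw [← tsum_mul_left]
  rw [e]
  show HasDerivAt (fun z : ℂ => ∑' k : ℕ, Complex.exp (Complex.I * Real.pi * (2 * k + 1) * z)
    / (2 * k + 1) ^ (j + 1)) _ z
  refine hasDerivAt_tsum_of_isPreconnected (t := {w : ℂ | δ < w.im}) (y₀ := z)
    (g := fun (k : ℕ) (z : ℂ) => Complex.exp (Complex.I * Real.pi * (2 * k + 1) * z)
      / (2 * k + 1) ^ (j + 1))
    (g' := fun (k : ℕ) (z : ℂ) => Complex.I * Real.pi *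
      (Complex.exp (Complex.I * Real.pi * (2 * k + 1) * z) / (2 * k + 1) ^ j))
    ((auxF_bound_summable h0).mul_left Real.pi)
    (isOpen_lt continuous_const Complex.continuous_im)
    (convex_halfSpace_im_gt δ).isPreconnected ?_ ?_ h1 (auxF_summable _ hz) h1
  · intro k y hy
    have h := (((hasDerivAt_id y).const_mul (Complex.I * Real.pi * (2 * k + 1))).cexp).div_const
      ((2 * (k:ℂ) + 1) ^ (j + 1))
    refine h.congr_deriv ?_
    have : (2 * (k:ℂ) + 1) ≠ 0 := by
      rw [← norm_ne_zero_iff, auxOdd_norm]; positivity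
    simp only [id]
    field_simp
    ring
  · intro k y hy
    rw [norm_mul]
    have : ‖Complex.I * (Real.pi : ℂ)‖ = Real.pi := by simp [abs_of_pos Real.pi_pos]
    rw [this]
    exact mul_le_mul_of_nonneg_left (auxF_term_bound j k y (le_of_lt hy) h0.le) Real.pi_pos.le

lemma auxOdd_summable {s : ℕ} (hs : 2 ≤ s) : Summable (fun k : ℕ => 1 / (2 * (k:ℝ) + 1) ^ s) := by
  refine Summable.of_nonneg_of_le (fun k => by positivity) (fun k => ?_) (zetaR_summable hs)
  apply one_div_le_one_div_of_le (by positivity)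
  exact pow_le_pow_left₀ (by positivity) (by linarith [(Nat.cast_nonneg k : (0:ℝ) ≤ k)]) _

lemma auxF_term_bound' (j k : ℕ) (z : ℂ) (hz : 0 ≤ z.im) :
    ‖Complex.exp (Complex.I * Real.pi * (2 * k + 1) * z) / (2 * k + 1) ^ j‖
      ≤ 1 / (2 * (k:ℝ) + 1) ^ j := by
  rw [norm_div, norm_pow, auxOdd_norm, auxF_norm]
  gcongr
  apply Real.exp_le_one_iff.2
  have := Real.pi_pos
  have : 0 ≤ Real.pi * (2 * k + 1) * z.im := by positivity
  linarith

lemma auxF_continuousOn {j : ℕ} (hj : 2 ≤ j) : ContinuousOn (auxF j) {z : ℂ | 0 ≤ z.im} := by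
  unfold auxF
  refine continuousOn_tsum (fun k => ?_) (auxOdd_summable hj) (fun k z hz => auxF_term_bound' j k z hz)
  fun_prop

lemma auxF_tendsto {j : ℕ} (hj : 2 ≤ j) (x : ℝ) :
    Filter.Tendsto (fun y : ℝ => auxF j (x + Complex.I * y)) (nhdsWithin 0 (Set.Ioi 0))
      (nhds (auxF j x)) := by
  have h : ContinuousWithinAt (auxF j) {z : ℂ | 0 ≤ z.im} (x:ℂ) :=
    auxF_continuousOn hj _ (by simp)
  refine h.tendsto.comp (tendsto_nhdsWithin_iff.2 ⟨?_, ?_⟩)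
  · have : Continuous (fun y : ℝ => (x + Complex.I * y : ℂ)) := by fun_prop
    have := this.tendsto 0
    simp only [Complex.ofReal_zero, mul_zero, add_zero] at this
    exact this.mono_left nhdsWithin_le_nhds
  · filter_upwards [self_mem_nhdsWithin] with y hy
    simpa using (le_of_lt hy : (0:ℝ) ≤ y)

/-! ### Expansion of the cosecant -/

lemma zetaR_complex {s : ℕ} : ((zetaR s : ℝ) : ℂ) = ∑' n : ℕ, 1 / ((n : ℂ) + 1) ^ s := by
  unfold zetaR
  rw [Complex.ofReal_tsum]
  push_cast
  rfl

lemma aux_double_summable {z : ℂ} (hz : ‖z‖ < 1) :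
    Summable (fun p : ℕ × ℕ => z ^ (2 * p.1 + 1) / ((p.2 : ℂ) + 1) ^ (2 * p.1 + 2)) := by
  have h1 : Summable (fun j : ℕ => (‖z‖ ^ 2) ^ j) :=
    summable_geometric_of_lt_one (by positivity) (by nlinarith [norm_nonneg z])
  have h2 := zetaR_summable (le_refl 2)
  have h3 := h1.mul_of_nonneg h2 (fun j => by positivity) (fun j => by positivity)
  refine Summable.of_norm_bounded h3 (fun p => ?_)
  have hn : ‖((p.2 : ℂ) + 1)‖ = (p.2 : ℝ) + 1 := by
    have : ((p.2 : ℂ) + 1) = (((p.2 : ℝ) + 1 : ℝ) : ℂ) := by push_cast; ring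
    rw [this, Complex.norm_real, Real.norm_of_nonneg (by positivity)]
  rw [norm_div, norm_pow, norm_pow, hn, div_eq_mul_one_div]
  refine mul_le_mul ?_ ?_ (by positivity) (by positivity)
  · rw [← pow_mul]
    exact pow_le_pow_of_le_one (norm_nonneg _) hz.le (by omega)
  · apply one_div_le_one_div_of_le (by positivity)
    exact pow_le_pow_right₀ (by linarith [(Nat.cast_nonneg p.2 : (0:ℝ) ≤ p.2)]) (by omega)

lemma aux_mem_compl {z : ℂ} (hz0 : 0 < z.im) : z ∈ Complex.integerComplement := by
  rintro ⟨n, hn⟩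
  rw [← hn] at hz0
  simp at hz0

lemma aux_zeta_summable {z : ℂ} (hz : ‖z‖ < 1) :
    Summable (fun j : ℕ => (zetaR (2 * j + 2) : ℂ) * z ^ (2 * j + 1)) := by
  have h := (aux_double_summable hz).prod
  refine h.congr (fun j => ?_)
  rw [zetaR_complex, ← tsum_mul_right]
  refine tsum_congr fun m => ?_
  ring

lemma aux_cot {z : ℂ} (hz0 : 0 < z.im) (hz : ‖z‖ < 1) :
    Real.pi * Complex.cot (Real.pi * z) = 1 / z - 2 * ∑' j : ℕ, (zetaR (2 * j + 2) : ℂ) * z ^ (2 * j + 1) := by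
  have h := cot_series_rep' (aux_mem_compl hz0)
  have hz00 : z ≠ 0 := by rintro rfl; simp at hz0
  have key : ∀ m : ℕ, (1 / (z - (m + 1)) + 1 / (z + (m + 1)))
      = -2 * ∑' j : ℕ, z ^ (2 * j + 1) / ((m : ℂ) + 1) ^ (2 * j + 2) := by
    intro m
    have hm : ((m : ℂ) + 1) ≠ 0 := by exact_mod_cast Nat.succ_ne_zero m
    have hmn : ‖((m : ℂ) + 1)‖ = (m : ℝ) + 1 := by
      have : ((m : ℂ) + 1) = (((m : ℝ) + 1 : ℝ) : ℂ) := by push_cast; ring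
      rw [this, Complex.norm_real, Real.norm_of_nonneg (by positivity)]
    have hlt : ‖z‖ < ‖((m : ℂ) + 1)‖ := by
      rw [hmn]; linarith [(Nat.cast_nonneg m : (0:ℝ) ≤ m)]
    have hr : ‖(z / (m + 1)) ^ 2‖ < 1 := by
      rw [norm_pow, norm_div]
      have : ‖z‖ / ‖((m : ℂ) + 1)‖ < 1 := (div_lt_one (by rw [hmn]; positivity)).2 hlt
      exact pow_lt_one₀ (by positivity) this (by norm_num)
    have hg := (hasSum_geometric_of_norm_lt_one hr).mul_left (z / ((m : ℂ) + 1) ^ 2)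
    have e : (fun j : ℕ => z / ((m : ℂ) + 1) ^ 2 * ((z / (m + 1)) ^ 2) ^ j)
        = fun j : ℕ => z ^ (2 * j + 1) / ((m : ℂ) + 1) ^ (2 * j + 2) := by
      funext j
      rw [← pow_mul, div_pow]
      field_simp
      ring
    rw [e] at hg
    rw [hg.tsum_eq]
    have h1 : z - (m + 1) ≠ 0 := by
      intro h0
      rw [sub_eq_zero.1 h0] at hlt
      exact lt_irrefl _ hlt
    have h2 : z + (m + 1) ≠ 0 := by
      intro h0
      rw [eq_neg_of_add_eq_zero_left h0, norm_neg] at hlt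
      exact lt_irrefl _ hlt
    have h3 : 1 - (z / (m + 1)) ^ 2 ≠ 0 := by
      intro h0
      rw [← sub_eq_zero.1 h0] at hr
      simp at hr
    have h4 : ((m:ℂ) + 1) ^ 2 - z ^ 2 ≠ 0 := by
      have : ((m:ℂ) + 1) ^ 2 - z ^ 2 = -((z - (m + 1)) * (z + (m + 1))) := by ring
      rw [this]; exact neg_ne_zero.2 (mul_ne_zero h1 h2)
    have h5 : 1 - (z / (m + 1)) ^ 2 = (((m:ℂ) + 1) ^ 2 - z ^ 2) / (m + 1) ^ 2 := by
      field_simp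
    rw [h5]
    field_simp
    ring
  rw [tsum_congr key, tsum_mul_left] at h
  have hs := aux_double_summable hz
  have hc := Summable.tsum_comm (f := fun (j m : ℕ) => z ^ (2 * j + 1) / ((m : ℂ) + 1) ^ (2 * j + 2)) hs
  rw [hc] at h
  have e2 : ∀ j : ℕ, ∑' m : ℕ, z ^ (2 * j + 1) / ((m : ℂ) + 1) ^ (2 * j + 2)
      = (zetaR (2 * j + 2) : ℂ) * z ^ (2 * j + 1) := by
    intro j
    rw [zetaR_complex, ← tsum_mul_right]
    refine tsum_congr fun m => ?_
    ring
  rw [tsum_congr e2] at h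
  linear_combination h

lemma aux_csc {z : ℂ} (hz0 : 0 < z.im) (hz : ‖z‖ < 1) :
    Real.pi / (2 * Complex.sin (Real.pi * z)) = 1 / (2 * z) + auxQ 0 z := by
  have hz2 : ‖z / 2‖ < 1 := by
    rw [norm_div]; simp; linarith [norm_nonneg z]
  have hz20 : 0 < (z / 2).im := by simp; linarith
  have h1 := aux_cot hz0 hz
  have h2 := aux_cot hz20 hz2
  have hs1 : Complex.sin (Real.pi * z) ≠ 0 := sin_pi_mul_ne_zero (aux_mem_compl hz0)
  have hs2 : Complex.sin (Real.pi * (z / 2)) ≠ 0 := sin_pi_mul_ne_zero (aux_mem_compl hz20)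
  have hz00 : z ≠ 0 := by rintro rfl; simp at hz0
  have e : 1 / Complex.sin (Real.pi * z)
      = Complex.cot (Real.pi * (z / 2)) - Complex.cot (Real.pi * z) := by
    rw [show (Real.pi : ℂ) * z = 2 * (Real.pi * (z / 2)) by ring] at hs1 ⊢
    generalize (Real.pi : ℂ) * (z / 2) = t at *
    rw [Complex.cot, Complex.cot]
    rw [Complex.sin_two_mul] at hs1 ⊢
    have hc : Complex.cos t ≠ 0 := right_ne_zero_of_mul hs1
    rw [Complex.cos_two_mul]
    field_simp
    ring
  have hq : auxQ 0 z = ∑' j : ℕ, ((zetaR (2 * j + 2) : ℂ) * z ^ (2 * j + 1)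
      - (zetaR (2 * j + 2) : ℂ) * (z / 2) ^ (2 * j + 1)) := by
    unfold auxQ auxGamma auxBeta
    refine tsum_congr fun j => ?_
    have : ((Nat.factorial (2 * j + 1) : ℕ) : ℂ) ≠ 0 := by
      exact_mod_cast Nat.factorial_ne_zero _
    push_cast
    rw [div_pow]
    field_simp
  rw [(aux_zeta_summable hz).tsum_sub (aux_zeta_summable hz2)] at hq
  have e3 : (Real.pi : ℂ) / (2 * Complex.sin (Real.pi * z))
      = (Real.pi * (1 / Complex.sin (Real.pi * z))) / 2 := by
    field_simp
  rw [e3, e, mul_sub, h1, h2, hq]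
  field_simp
  ring

lemma aux_F0 {z : ℂ} (hz0 : 0 < z.im) :
    Complex.I * Real.pi * auxF 0 z = -(Real.pi / (2 * Complex.sin (Real.pi * z))) := by
  have hs1 : Complex.sin (Real.pi * z) ≠ 0 := sin_pi_mul_ne_zero (aux_mem_compl hz0)
  set q := Complex.exp (Complex.I * Real.pi * z) with hq
  have hq0 : q ≠ 0 := Complex.exp_ne_zero _
  have hqn : ‖q‖ < 1 := by
    have := auxF_norm 0 z
    simp only [Nat.cast_zero, mul_zero, zero_add, mul_one] at this
    rw [hq, this]
    apply Real.exp_lt_one_iff.2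
    have := mul_pos Real.pi_pos hz0
    linarith
  have hr : ‖q ^ 2‖ < 1 := by
    rw [norm_pow]; exact pow_lt_one₀ (norm_nonneg _) hqn (by norm_num)
  have hF : auxF 0 z = q / (1 - q ^ 2) := by
    unfold auxF
    have hg := (hasSum_geometric_of_norm_lt_one hr).mul_left q
    rw [div_eq_mul_inv, ← hg.tsum_eq]
    refine tsum_congr fun k => ?_
    rw [pow_zero, div_one, ← pow_mul, ← pow_succ', hq, ← Complex.exp_nat_mul]
    congr 1
    push_cast
    ring
  have hsin : Complex.sin (Real.pi * z) = (q⁻¹ - q) * Complex.I / 2 := by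
    rw [Complex.sin, hq, ← Complex.exp_neg]
    congr 3
    · congr 1; ring
    · congr 1; ring
  have h1 : 1 - q ^ 2 ≠ 0 := by
    intro h0
    rw [← sub_eq_zero.1 h0] at hr
    simp at hr
  have h2 : q⁻¹ - q = (1 - q ^ 2) / q := by field_simp
  rw [hF, hsin, h2]
  field_simp
  rw [Complex.I_sq]

/-! ### Integrating up to the fourth level -/

lemma aux_const {f g f' : ℂ → ℂ}
    (hf : ∀ z : ℂ, 0 < z.im → ‖z‖ < 1 → HasDerivAt f (f' z) z)
    (hg : ∀ z : ℂ, 0 < z.im → ‖z‖ < 1 → HasDerivAt g (f' z) z) :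
    ∃ c : ℂ, ∀ z : ℂ, 0 < z.im → ‖z‖ < 1 → f z = g z + c := by
  have ho : IsOpen ({z : ℂ | 0 < z.im} ∩ Metric.ball 0 1) :=
    (isOpen_lt continuous_const Complex.continuous_im).inter Metric.isOpen_ball
  have hp : IsPreconnected ({z : ℂ | 0 < z.im} ∩ Metric.ball 0 1) :=
    ((convex_halfSpace_im_gt 0).inter (convex_ball _ _)).isPreconnected
  obtain ⟨c, hc⟩ := ho.exists_is_const_of_deriv_eq_zero hp (f := fun z => f z - g z)
    (fun z hz => ((hf z hz.1 (by simpa using hz.2)).sub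
      (hg z hz.1 (by simpa using hz.2))).differentiableAt.differentiableWithinAt)
    (fun z hz => by
      have := ((hf z hz.1 (by simpa using hz.2)).sub (hg z hz.1 (by simpa using hz.2))).deriv
      show deriv (f - g) z = 0
      rw [this, sub_self])
  refine ⟨c, fun z h1 h2 => ?_⟩
  have := hc z ⟨h1, by simpa using h2⟩
  rw [← this]; ring

lemma aux_level1 : ∃ c : ℂ, ∀ z : ℂ, 0 < z.im → ‖z‖ < 1 →
    auxF 1 z = (-(1 / 2) * Complex.log z - auxQ 1 z) + c := by
  refine aux_const (f' := fun z => Complex.I * Real.pi * auxF 0 z)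
    (fun z h1 h2 => auxF_hasDerivAt 0 h1) (fun z h1 h2 => ?_)
  have hs : z ∈ Complex.slitPlane := Or.inr h1.ne'
  refine (((Complex.hasDerivAt_log hs).const_mul (-(1/2 : ℂ))).sub
    (auxQ_hasDerivAt 0 h2)).congr_deriv ?_
  rw [aux_F0 h1, aux_csc h1 h2]
  have hz00 : z ≠ 0 := by rintro rfl; simp at h1
  field_simp
  ring

lemma aux_eventually (x : ℝ) (hx0 : 0 ≤ x) (hx : x < 1) :
    ∀ᶠ y : ℝ in nhdsWithin 0 (Set.Ioi 0),
      0 < (x + Complex.I * y : ℂ).im ∧ ‖(x + Complex.I * y : ℂ)‖ < 1 := by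
  have hc : Continuous (fun y : ℝ => ‖(x + Complex.I * y : ℂ)‖) := by fun_prop
  have ht := hc.tendsto 0
  have h2 : ∀ᶠ y : ℝ in nhds 0, ‖(x + Complex.I * y : ℂ)‖ < 1 := by
    refine ht.eventually (gt_mem_nhds ?_)
    simp [abs_of_nonneg hx0, hx]
  filter_upwards [self_mem_nhdsWithin, nhdsWithin_le_nhds h2] with y hy hy2
  exact ⟨by simpa using hy, hy2⟩

lemma aux_path (x : ℝ) :
    Filter.Tendsto (fun y : ℝ => (x + Complex.I * y : ℂ)) (nhdsWithin 0 (Set.Ioi 0))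
      (nhds (x:ℂ)) := by
  have : Continuous (fun y : ℝ => (x + Complex.I * y : ℂ)) := by fun_prop
  have := this.tendsto 0
  simp only [Complex.ofReal_zero, mul_zero, add_zero] at this
  exact this.mono_left nhdsWithin_le_nhds

lemma aux_path0 :
    Filter.Tendsto (fun y : ℝ => (Complex.I * y : ℂ)) (nhdsWithin 0 (Set.Ioi 0))
      (nhds 0) := by
  simpa using aux_path 0

lemma aux_log_path {y : ℝ} (hy : 0 < y) :
    Complex.log (Complex.I * y) = Real.log y + Complex.I * (Real.pi / 2) := by
  rw [mul_comm, Complex.log_ofReal_mul hy Complex.I_ne_zero, Complex.log_I]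
  ring

lemma aux_zlogz :
    Filter.Tendsto (fun y : ℝ => (Complex.I * y : ℂ) * Complex.log (Complex.I * y))
      (nhdsWithin 0 (Set.Ioi 0)) (nhds 0) := by
  have h : Continuous (fun y : ℝ => Complex.I * ((y * Real.log y : ℝ) : ℂ) - y * (Real.pi / 2)) := by
    have := Real.continuous_mul_log
    fun_prop
  have h2 := (h.tendsto 0).mono_left (nhdsWithin_le_nhds (s := Set.Ioi 0))
  simp only [Complex.ofReal_zero, zero_mul, mul_zero, sub_zero] at h2
  refine h2.congr' ?_
  filter_upwards [self_mem_nhdsWithin] with y hy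
  rw [aux_log_path hy]
  push_cast
  linear_combination (-(y:ℂ) * (Real.pi / 2)) * Complex.I_sq

lemma aux_F1_path {y : ℝ} (hy : 0 < y) :
    auxF 1 (Complex.I * y) = ((1 / 2 * (Real.log (1 + Real.exp (-(Real.pi * y)))
      - Real.log (1 - Real.exp (-(Real.pi * y)))) : ℝ) : ℂ) := by
  have hq : |Real.exp (-(Real.pi * y))| < 1 := by
    rw [abs_of_pos (Real.exp_pos _)]
    apply Real.exp_lt_one_iff.2
    have := mul_pos Real.pi_pos hy
    linarith
  have h := (Real.hasSum_log_sub_log_of_abs_lt_one hq).mul_left (1 / 2)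
  rw [← h.tsum_eq, Complex.ofReal_tsum]
  unfold auxF
  refine tsum_congr fun k => ?_
  have e : Complex.exp (Complex.I * Real.pi * (2 * k + 1) * (Complex.I * y))
      = ((Real.exp (-(Real.pi * y)) ^ (2 * k + 1) : ℝ) : ℂ) := by
    rw [← Real.exp_nat_mul]
    push_cast
    congr 1
    linear_combination (Real.pi * (2 * k + 1) * y : ℂ) * Complex.I_sq
  rw [e]
  push_cast
  ring

lemma aux_c1 {c : ℂ} (hc : ∀ z : ℂ, 0 < z.im → ‖z‖ < 1 →
    auxF 1 z = (-(1 / 2) * Complex.log z - auxQ 1 z) + c) :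
    c.re = 1 / 2 * (Real.log 2 - Real.log Real.pi) := by
  have hQ : Filter.Tendsto (fun y : ℝ => (auxQ 1 (Complex.I * y)).re)
      (nhdsWithin 0 (Set.Ioi 0)) (nhds 0) := by
    have h1 := (auxQ_continuousAt 0 (z := 0) (by simp)).tendsto.comp aux_path0
    rw [auxQ_zero] at h1
    simpa [Function.comp_def] using (Complex.continuous_re.tendsto _).comp h1
  have hd : HasDerivAt (fun y : ℝ => 1 - Real.exp (-(Real.pi * y))) Real.pi 0 := by
    have := (((hasDerivAt_id (0:ℝ)).const_mul Real.pi).neg.exp).const_sub 1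
    simpa using this
  have hsl := hd.tendsto_slope_zero_right
  have hlog : Filter.Tendsto (fun y : ℝ => Real.log (y⁻¹ * (1 - Real.exp (-(Real.pi * y)))))
      (nhdsWithin 0 (Set.Ioi 0)) (nhds (Real.log Real.pi)) := by
    refine Filter.Tendsto.log ?_ Real.pi_ne_zero
    simpa using hsl
  have hlog2 : Filter.Tendsto (fun y : ℝ => Real.log (1 + Real.exp (-(Real.pi * y))))
      (nhdsWithin 0 (Set.Ioi 0)) (nhds (Real.log 2)) := by
    have hcont : Continuous (fun y : ℝ => 1 + Real.exp (-(Real.pi * y))) := by fun_prop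
    have := (hcont.tendsto 0).mono_left (nhdsWithin_le_nhds (s := Set.Ioi 0))
    refine Filter.Tendsto.log ?_ two_ne_zero
    convert this using 2
    norm_num
  have hlim := ((hlog2.sub hlog).const_mul (1 / 2)).add hQ
  rw [add_zero] at hlim
  refine tendsto_nhds_unique (tendsto_const_nhds.congr' ?_) hlim
  filter_upwards [self_mem_nhdsWithin, aux_eventually 0 le_rfl one_pos] with y hy hy2
  have hy0 : 0 < y := hy
  simp only [Complex.ofReal_zero, zero_add] at hy2
  have h := congrArg Complex.re (hc _ hy2.1 hy2.2)
  rw [aux_F1_path hy0, aux_log_path hy0] at h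
  have hpos : 0 < 1 - Real.exp (-(Real.pi * y)) := by
    have : Real.exp (-(Real.pi * y)) < 1 := by
      apply Real.exp_lt_one_iff.2
      have := mul_pos Real.pi_pos hy0
      linarith
    linarith
  rw [Real.log_mul (inv_ne_zero hy0.ne') hpos.ne', Real.log_inv]
  simp only [Complex.ofReal_re, Complex.add_re, Complex.sub_re, Complex.mul_re] at h
  norm_num at h
  linarith

lemma aux_limit_const {f g : ℂ → ℂ} {c a : ℂ}
    (h : ∀ z : ℂ, 0 < z.im → ‖z‖ < 1 → f z = g z + c)
    (hf : Filter.Tendsto (fun y : ℝ => f (Complex.I * y)) (nhdsWithin 0 (Set.Ioi 0)) (nhds a))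
    (hg : Filter.Tendsto (fun y : ℝ => g (Complex.I * y)) (nhdsWithin 0 (Set.Ioi 0)) (nhds 0)) :
    c = a := by
  have := hf.sub hg
  rw [sub_zero] at this
  refine tendsto_nhds_unique (tendsto_const_nhds.congr' ?_) this
  filter_upwards [aux_eventually 0 le_rfl one_pos] with y hy2
  simp only [Complex.ofReal_zero, zero_add] at hy2
  rw [h _ hy2.1 hy2.2]; ring

lemma auxQ_path0 (j : ℕ) : Filter.Tendsto (fun y : ℝ => auxQ (j + 1) (Complex.I * y))
      (nhdsWithin 0 (Set.Ioi 0)) (nhds 0) := by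
  have h1 := (auxQ_continuousAt j (z := 0) (by simp)).tendsto.comp aux_path0
  rwa [auxQ_zero] at h1

lemma auxF_path0 {j : ℕ} (hj : 2 ≤ j) : Filter.Tendsto (fun y : ℝ => auxF j (Complex.I * y))
      (nhdsWithin 0 (Set.Ioi 0)) (nhds (auxF j 0)) := by
  simpa using auxF_tendsto hj 0

lemma aux_level2 {c : ℂ} (hc : ∀ z : ℂ, 0 < z.im → ‖z‖ < 1 →
    auxF 1 z = (-(1 / 2) * Complex.log z - auxQ 1 z) + c) :
    ∀ z : ℂ, 0 < z.im → ‖z‖ < 1 → auxF 2 z =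
      Complex.I * Real.pi * (-(1 / 2) * (z * Complex.log z - z) + c * z - auxQ 2 z)
        + auxF 2 0 := by
  obtain ⟨e, he⟩ := aux_const (f := auxF 2)
    (g := fun z => Complex.I * Real.pi * (-(1 / 2) * (z * Complex.log z - z) + c * z - auxQ 2 z))
    (f' := fun z => Complex.I * Real.pi * auxF 1 z)
    (fun z h1 h2 => auxF_hasDerivAt 1 h1) (fun z h1 h2 => by
      have hs : z ∈ Complex.slitPlane := Or.inr h1.ne'
      have hz00 : z ≠ 0 := by rintro rfl; simp at h1
      have hl := Complex.hasDerivAt_log hs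
      have hi := hasDerivAt_id z
      refine ((((((hi.mul hl).sub hi).const_mul (-(1/2 : ℂ))).add (hi.const_mul c)).sub
        (auxQ_hasDerivAt 1 h2)).const_mul (Complex.I * Real.pi)).congr_deriv ?_
      rw [hc z h1 h2]
      simp only [id]
      field_simp
      ring)
  have : e = auxF 2 0 := by
    refine aux_limit_const he (auxF_path0 le_rfl) ?_
    have := (((((aux_zlogz.sub aux_path0).const_mul (-(1/2 : ℂ))).add
      (aux_path0.const_mul c)).sub (auxQ_path0 1)).const_mul (Complex.I * Real.pi))
    simpa using this
  rw [this] at he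
  exact he

lemma aux_level3 {c : ℂ} (hc : ∀ z : ℂ, 0 < z.im → ‖z‖ < 1 →
    auxF 1 z = (-(1 / 2) * Complex.log z - auxQ 1 z) + c) :
    ∀ z : ℂ, 0 < z.im → ‖z‖ < 1 → auxF 3 z =
      ((Complex.I * Real.pi) ^ 2 * (-(1 / 4) * (z * (z * Complex.log z)) + (3 / 8 + c / 2) * z ^ 2
          - auxQ 3 z)
        + Complex.I * Real.pi * auxF 2 0 * z) + auxF 3 0 := by
  obtain ⟨e, he⟩ := aux_const (f := auxF 3)
    (g := fun z => (Complex.I * Real.pi) ^ 2 *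
      (-(1 / 4) * (z * (z * Complex.log z)) + (3 / 8 + c / 2) * z ^ 2 - auxQ 3 z)
        + Complex.I * Real.pi * auxF 2 0 * z)
    (f' := fun z => Complex.I * Real.pi * auxF 2 z)
    (fun z h1 h2 => auxF_hasDerivAt 2 h1) (fun z h1 h2 => by
      have hs : z ∈ Complex.slitPlane := Or.inr h1.ne'
      have hz00 : z ≠ 0 := by rintro rfl; simp at h1
      have hl := Complex.hasDerivAt_log hs
      have hi := hasDerivAt_id z
      refine (((((hi.mul (hi.mul hl)).const_mul (-(1/4 : ℂ))).add
        ((hasDerivAt_pow 2 z).const_mul (3 / 8 + c / 2))).sub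
        (auxQ_hasDerivAt 2 h2)).const_mul ((Complex.I * Real.pi) ^ 2)).add
        (hi.const_mul (Complex.I * Real.pi * auxF 2 0)) |>.congr_deriv ?_
      rw [aux_level2 hc z h1 h2]
      simp only [id, Pi.mul_apply]
      field_simp
      push_cast
      ring)
  have : e = auxF 3 0 := by
    refine aux_limit_const he (auxF_path0 (by norm_num)) ?_
    have := (((((aux_path0.mul aux_zlogz).const_mul (-(1/4 : ℂ))).add
      ((aux_path0.pow 2).const_mul (3 / 8 + c / 2))).sub
      (auxQ_path0 2)).const_mul ((Complex.I * Real.pi) ^ 2)).add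
        (aux_path0.const_mul (Complex.I * Real.pi * auxF 2 0))
    simpa using this
  rw [this] at he
  exact he

lemma aux_level4 {c : ℂ} (hc : ∀ z : ℂ, 0 < z.im → ‖z‖ < 1 →
    auxF 1 z = (-(1 / 2) * Complex.log z - auxQ 1 z) + c) :
    ∀ z : ℂ, 0 < z.im → ‖z‖ < 1 → auxF 4 z =
      ((Complex.I * Real.pi) ^ 3 * (-(1 / 12) * (z ^ 2 * (z * Complex.log z))
          + (11 / 72 + c / 6) * z ^ 3 - auxQ 4 z)
        + ((Complex.I * Real.pi) ^ 2 * auxF 2 0 / 2) * z ^ 2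
        + Complex.I * Real.pi * auxF 3 0 * z) + auxF 4 0 := by
  obtain ⟨e, he⟩ := aux_const (f := auxF 4)
    (g := fun z => (Complex.I * Real.pi) ^ 3 * (-(1 / 12) * (z ^ 2 * (z * Complex.log z))
          + (11 / 72 + c / 6) * z ^ 3 - auxQ 4 z)
        + ((Complex.I * Real.pi) ^ 2 * auxF 2 0 / 2) * z ^ 2
        + Complex.I * Real.pi * auxF 3 0 * z)
    (f' := fun z => Complex.I * Real.pi * auxF 3 z)
    (fun z h1 h2 => auxF_hasDerivAt 3 h1) (fun z h1 h2 => by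
      have hs : z ∈ Complex.slitPlane := Or.inr h1.ne'
      have hz00 : z ≠ 0 := by rintro rfl; simp at h1
      have hl := Complex.hasDerivAt_log hs
      have hi := hasDerivAt_id z
      refine ((((((hasDerivAt_pow 2 z).mul (hi.mul hl)).const_mul (-(1/12 : ℂ))).add
        ((hasDerivAt_pow 3 z).const_mul (11 / 72 + c / 6))).sub
        (auxQ_hasDerivAt 3 h2)).const_mul ((Complex.I * Real.pi) ^ 3)).add
        ((hasDerivAt_pow 2 z).const_mul ((Complex.I * Real.pi) ^ 2 * auxF 2 0 / 2)) |>.add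
        (hi.const_mul (Complex.I * Real.pi * auxF 3 0)) |>.congr_deriv ?_
      rw [aux_level3 hc z h1 h2]
      simp only [id, Pi.mul_apply]
      field_simp
      push_cast
      ring)
  have : e = auxF 4 0 := by
    refine aux_limit_const he (auxF_path0 (by norm_num)) ?_
    have := ((((((aux_path0.pow 2).mul aux_zlogz).const_mul (-(1/12 : ℂ))).add
      ((aux_path0.pow 3).const_mul (11 / 72 + c / 6))).sub
      (auxQ_path0 3)).const_mul ((Complex.I * Real.pi) ^ 3)).add
        ((aux_path0.pow 2).const_mul ((Complex.I * Real.pi) ^ 2 * auxF 2 0 / 2)) |>.add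
        (aux_path0.const_mul (Complex.I * Real.pi * auxF 3 0))
    simpa using this
  rw [this] at he
  exact he

lemma aux_boundary {c : ℂ} (hc : ∀ z : ℂ, 0 < z.im → ‖z‖ < 1 →
    auxF 1 z = (-(1 / 2) * Complex.log z - auxQ 1 z) + c) (x : ℝ) (hx0 : 0 < x) (hx1 : x < 1) :
    auxF 4 x =
      ((Complex.I * Real.pi) ^ 3 * (-(1 / 12) * ((x:ℂ) ^ 2 * (x * Complex.log x))
          + (11 / 72 + c / 6) * (x:ℂ) ^ 3 - auxQ 4 x)
        + ((Complex.I * Real.pi) ^ 2 * auxF 2 0 / 2) * (x:ℂ) ^ 2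
        + Complex.I * Real.pi * auxF 3 0 * x) + auxF 4 0 := by
  have hlog : Filter.Tendsto (fun y : ℝ => Complex.log (x + Complex.I * y : ℂ))
      (nhdsWithin 0 (Set.Ioi 0)) (nhds (Complex.log x)) :=
    (aux_path x).clog (Or.inl (by simpa using hx0))
  have hq : Filter.Tendsto (fun y : ℝ => auxQ 4 (x + Complex.I * y : ℂ))
      (nhdsWithin 0 (Set.Ioi 0)) (nhds (auxQ 4 x)) :=
    (auxQ_continuousAt 3 (z := (x:ℂ)) (by simp [abs_of_pos hx0, hx1])).tendsto.comp (aux_path x)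
  have hp := aux_path x
  have hlim := ((((((hp.pow 2).mul (hp.mul hlog)).const_mul (-(1/12 : ℂ))).add
      ((hp.pow 3).const_mul (11 / 72 + c / 6))).sub hq).const_mul ((Complex.I * Real.pi) ^ 3)).add
        ((hp.pow 2).const_mul ((Complex.I * Real.pi) ^ 2 * auxF 2 0 / 2)) |>.add
        (hp.const_mul (Complex.I * Real.pi * auxF 3 0)) |>.add_const (auxF 4 0)
  refine tendsto_nhds_unique (auxF_tendsto (by norm_num) x) (hlim.congr' ?_)
  filter_upwards [aux_eventually x hx0.le hx1] with y hy
  rw [aux_level4 hc _ hy.1 hy.2]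

/-! ### The real identity -/

lemma aux_zero_real (j : ℕ) : auxF j 0 = ((∑' k : ℕ, 1 / (2 * (k:ℝ) + 1) ^ j : ℝ) : ℂ) := by
  unfold auxF
  rw [Complex.ofReal_tsum]
  refine tsum_congr fun k => ?_
  simp

lemma aux_zeta3 : ∑' k : ℕ, 1 / (2 * (k:ℝ) + 1) ^ 3 = 7 / 8 * zetaR 3 := by
  have hs : Summable (fun n : ℕ => 1 / (n:ℝ) ^ 3) := Real.summable_one_div_nat_pow.2 (by norm_num)
  have h0 : ∑' n : ℕ, 1 / (n:ℝ) ^ 3 = zetaR 3 := by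
    rw [hs.tsum_eq_zero_add]
    unfold zetaR
    simp
  have he : Summable (fun k : ℕ => 1 / ((2 * k : ℕ):ℝ) ^ 3) :=
    hs.comp_injective (i := fun k : ℕ => 2 * k) (fun a b h => by simpa using h)
  have ho : Summable (fun k : ℕ => 1 / ((2 * k + 1 : ℕ):ℝ) ^ 3) :=
    hs.comp_injective (i := fun k : ℕ => 2 * k + 1) (fun a b h => by simpa using h)
  have h := tsum_even_add_odd (f := fun n : ℕ => 1 / (n:ℝ) ^ 3) he ho
  have h2 : ∑' k : ℕ, 1 / ((2 * k : ℕ):ℝ) ^ 3 = 1 / 8 * zetaR 3 := by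
    rw [← h0, ← tsum_mul_left]
    refine tsum_congr fun k => ?_
    push_cast
    rw [mul_pow, div_mul_div_comm]
    norm_num
  rw [h0, h2] at h
  push_cast at h
  linarith

lemma aux_im4 (x : ℝ) :
    ∑' k : ℕ, 1 / (2 * (k:ℝ) + 1) ^ 4 * Real.sin ((2 * (k:ℝ) + 1) * Real.pi * x) = (auxF 4 x).im := by
  unfold auxF
  have hs : Summable (fun k : ℕ => Complex.exp (Complex.I * Real.pi * (2 * k + 1) * (x:ℂ))
      / (2 * k + 1) ^ 4) :=
    .of_norm_bounded (auxOdd_summable (by norm_num : 2 ≤ 4))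
      (fun k => auxF_term_bound' 4 k _ (by simp))
  rw [Complex.im_tsum hs]
  refine tsum_congr fun k => ?_
  have e : Complex.exp (Complex.I * Real.pi * (2 * k + 1) * (x:ℂ)) / (2 * k + 1) ^ 4
      = ((1 / (2 * (k:ℝ) + 1) ^ 4 : ℝ) : ℂ) * Complex.exp (((2 * (k:ℝ) + 1) * Real.pi * x : ℝ) * Complex.I) := by
    push_cast
    rw [div_eq_mul_one_div, mul_comm]
    congr 2
    ring
  rw [e, Complex.im_ofReal_mul, Complex.exp_ofReal_mul_I_im]

lemma auxQ_real (x : ℝ) : auxQ 4 x = ((∑' n : ℕ, auxGamma 4 n * x ^ (2 * n + 5) : ℝ) : ℂ) := by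
  unfold auxQ
  rw [Complex.ofReal_tsum]
  refine tsum_congr fun n => ?_
  push_cast
  rfl

lemma aux_main (x : ℝ) (hx0 : 0 ≤ x) (hx1 : x < 1) :
    (96 / Real.pi ^ 4) * ∑' k : ℕ, 1 / (2 * (k:ℝ) + 1) ^ 4 * Real.sin ((2 * (k:ℝ) + 1) * Real.pi * x)
      = (84 / Real.pi ^ 3) * x * zetaR 3 + (8 / Real.pi) * x ^ 3 * Real.log (Real.pi * x)
    - (8 / Real.pi) * (11 / 6 + Real.log 2) * x ^ 3
    + (96 / Real.pi) * ∑' n : ℕ, auxGamma 4 n * x ^ (2 * n + 5) := by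
  rcases hx0.eq_or_lt with rfl | hx0
  · simp
  obtain ⟨c, hc⟩ := aux_level1
  have hcr := aux_c1 hc
  have h := congrArg Complex.im (aux_boundary hc x hx0 hx1)
  rw [auxQ_real, aux_zero_real 2, aux_zero_real 3, aux_zero_real 4, aux_zeta3,
    ← Complex.ofReal_log hx0.le] at h
  set A := ∑' n : ℕ, auxGamma 4 n * x ^ (2 * n + 5)
  set B := ∑' k : ℕ, 1 / (2 * (k:ℝ) + 1) ^ 2
  set C := ∑' k : ℕ, 1 / (2 * (k:ℝ) + 1) ^ 4
  set L := Real.log x with hL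
  have e : ((Complex.I * Real.pi) ^ 3 * (-(1 / 12) * ((x:ℂ) ^ 2 * (x * (L:ℂ)))
          + (11 / 72 + c / 6) * (x:ℂ) ^ 3 - (A:ℂ))
        + ((Complex.I * Real.pi) ^ 2 * (B:ℂ) / 2) * (x:ℂ) ^ 2
        + Complex.I * Real.pi * ((7 / 8 * zetaR 3 : ℝ):ℂ) * x) + (C:ℂ)
      = ((Real.pi ^ 3 * (1 / 12 * x ^ 3 * L - 11 / 72 * x ^ 3 + A)
          + Real.pi * (7 / 8 * zetaR 3) * x : ℝ) : ℂ) * Complex.I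
        + ((- (Real.pi ^ 2) * B / 2 * x ^ 2 + C : ℝ) : ℂ)
        + ((- Real.pi ^ 3 * x ^ 3 / 6 : ℝ) : ℂ) * (Complex.I * c) := by
    have h3 : Complex.I ^ 3 = -Complex.I := Complex.I_pow_three
    rw [mul_pow, mul_pow, h3, Complex.I_sq]
    push_cast
    ring
  rw [e] at h
  simp only [Complex.add_im, Complex.im_ofReal_mul, Complex.ofReal_im, Complex.I_im, Complex.I_mul_im] at h
  rw [aux_im4, h, hcr, Real.log_mul Real.pi_ne_zero hx0.ne', ← hL]
  have := Real.pi_ne_zero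
  field_simp
  ring

lemma aux_sin3 (x : ℝ) (hx : x ∈ Set.Icc (0:ℝ) 1) :
    HasSum (fun k : ℕ => 1 / (2 * (k:ℝ) + 1) ^ 3 * Real.sin ((2 * (k:ℝ) + 1) * Real.pi * x))
      (Real.pi ^ 3 * x * (1 - x) / 8) := by
  have hB : ∀ y : ℝ, (Polynomial.map (algebraMap ℚ ℝ) (Polynomial.bernoulli 3)).eval y
      = y ^ 3 - 3 / 2 * y ^ 2 + 1 / 2 * y := by
    intro y
    rw [Polynomial.bernoulli]
    simp [Finset.sum_range_succ, bernoulli_eq_bernoulli'_of_ne_one, bernoulli_one, bernoulli'_two,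
      bernoulli'_three, Nat.choose]
    ring
  have h1 := hasSum_one_div_nat_pow_mul_sin one_ne_zero hx
  have h2 := hasSum_one_div_nat_pow_mul_sin one_ne_zero
    (x := x / 2) ⟨by linarith [hx.1], by linarith [hx.2, hx.1]⟩
  simp only [mul_one, Nat.reduceAdd] at h1 h2
  rw [hB] at h1 h2
  have he : HasSum (fun k : ℕ => 1 / ((2 * k : ℕ):ℝ) ^ 3 * Real.sin (2 * Real.pi * ((2 * k : ℕ):ℝ) * (x / 2)))
      (1 / 8 * ((-1) ^ (1 + 1) * (2 * Real.pi) ^ 3 / 2 / (Nat.factorial 3) * (x ^ 3 - 3 / 2 * x ^ 2 + 1 / 2 * x))) := by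
    have e : (fun k : ℕ => 1 / ((2 * k : ℕ):ℝ) ^ 3 * Real.sin (2 * Real.pi * ((2 * k : ℕ):ℝ) * (x / 2)))
        = fun k : ℕ => 1 / 8 * (1 / (k:ℝ) ^ 3 * Real.sin (2 * Real.pi * k * x)) := by
      funext k
      push_cast
      rw [show 2 * Real.pi * (2 * (k:ℝ)) * (x / 2) = 2 * Real.pi * k * x by ring, mul_pow]
      by_cases hk : (k:ℝ) = 0
      · simp [hk]
      · field_simp
        norm_num
        ring
    rw [e]
    exact h1.mul_left (1/8)
  have ho : Summable (fun k : ℕ => 1 / ((2 * k + 1 : ℕ):ℝ) ^ 3 * Real.sin (2 * Real.pi * ((2 * k + 1 : ℕ):ℝ) * (x / 2))) :=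
    h2.summable.comp_injective (i := fun k : ℕ => 2 * k + 1) (fun a b h => by simpa using h)
  have h := HasSum.even_add_odd (f := fun n : ℕ => 1 / (n:ℝ) ^ 3 * Real.sin (2 * Real.pi * (n:ℝ) * (x / 2)))
    he ho.hasSum
  have hu := h.unique h2
  have ho2 := ho.hasSum
  set T := ∑' k : ℕ, 1 / ((2 * k + 1 : ℕ):ℝ) ^ 3 * Real.sin (2 * Real.pi * ((2 * k + 1 : ℕ):ℝ) * (x / 2))
  have e : T = Real.pi ^ 3 * x * (1 - x) / 8 := by
    norm_num [Nat.factorial] at hu ⊢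
    linear_combination hu
  rw [e] at ho2
  have e2 : (fun k : ℕ => 1 / (2 * (k:ℝ) + 1) ^ 3 * Real.sin ((2 * (k:ℝ) + 1) * Real.pi * x))
      = fun k : ℕ => 1 / ((2 * k + 1 : ℕ):ℝ) ^ 3 * Real.sin (2 * Real.pi * ((2 * k + 1 : ℕ):ℝ) * (x / 2)) := by
    funext k
    push_cast
    congr 2
    ring
  rw [e2]
  exact ho2

/-! ### Error estimates -/

lemma aux_d_eq (n : ℕ) : 0 ≤ d n ∧ d n ≤ 2 * Real.exp (-(n * Real.pi)) := by
  unfold d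
  set u := (n:ℝ) * Real.pi / 2 with hu
  have hc := Real.cosh_pos u
  have e : 1 - Real.tanh u = Real.exp (-u) / Real.cosh u := by
    rw [Real.tanh_eq_sinh_div_cosh, ← Real.cosh_sub_sinh]
    field_simp
  rw [e]
  refine ⟨by positivity, ?_⟩
  rw [div_le_iff₀ hc, Real.cosh_eq]
  have h1 : Real.exp (-u) = Real.exp (-(n * Real.pi)) * Real.exp u := by
    rw [← Real.exp_add, hu]; congr 1; ring
  have h2 := mul_pos (Real.exp_pos (-(n * Real.pi))) (Real.exp_pos (-u))
  nlinarith

lemma aux_dterm (x : ℝ) (i : ℕ) :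
    |d (2 * i + 1) / (2 * (i : ℝ) + 1) ^ 4 * Real.sin ((2 * (i : ℝ) + 1) * Real.pi * x)|
      ≤ 2 * Real.exp (-((2 * i + 1) * Real.pi)) / (2 * (i : ℝ) + 1) ^ 4 := by
  obtain ⟨h0, h1⟩ := aux_d_eq (2 * i + 1)
  push_cast at h1
  rw [abs_mul, abs_of_nonneg (by positivity)]
  refine (mul_le_of_le_one_right (by positivity) (Real.abs_sin_le_one _)).trans ?_
  gcongr

lemma aux_dsummable (x : ℝ) : Summable (fun i : ℕ =>
    d (2 * i + 1) / (2 * (i : ℝ) + 1) ^ 4 * Real.sin ((2 * (i : ℝ) + 1) * Real.pi * x)) := by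
  refine Summable.of_norm_bounded ((auxOdd_summable (by norm_num : 2 ≤ 4)).mul_left 2) (fun i => ?_)
  rw [Real.norm_eq_abs]
  refine (aux_dterm x i).trans ?_
  rw [mul_one_div]
  gcongr
  have : Real.exp (-((2 * i + 1) * Real.pi)) ≤ 1 := by
    apply Real.exp_le_one_iff.2
    have := Real.pi_pos
    have : 0 ≤ (2 * (i:ℝ) + 1) * Real.pi := by positivity
    linarith
  linarith

lemma aux_psi (x : ℝ) (hx : x ∈ Set.Icc (0:ℝ) (1/2)) :
    psi x = (84 / Real.pi ^ 3) * x * zetaR 3 + (8 / Real.pi) * x ^ 3 * Real.log (Real.pi * x)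
    - (8 / Real.pi) * (11 / 6 + Real.log 2) * x ^ 3 - 3 * x * (1 - x)
    + (96 / Real.pi) * ∑' n : ℕ, auxGamma 4 n * x ^ (2 * n + 5)
    - (96 / Real.pi ^ 4) * ∑' i : ℕ,
      d (2 * i + 1) / (2 * (i : ℝ) + 1) ^ 4 * Real.sin ((2 * (i : ℝ) + 1) * Real.pi * x) := by
  have hm := aux_main x hx.1 (by linarith [hx.2])
  have h3 := aux_sin3 x ⟨hx.1, by linarith [hx.2]⟩
  have hd := (aux_dsummable x).hasSum
  have hs4 : Summable (fun k : ℕ => 1 / (2 * (k:ℝ) + 1) ^ 4 * Real.sin ((2 * (k:ℝ) + 1) * Real.pi * x)) := by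
    refine Summable.of_norm_bounded (auxOdd_summable (by norm_num : 2 ≤ 4)) (fun k => ?_)
    rw [Real.norm_eq_abs, abs_mul, abs_of_nonneg (by positivity)]
    exact mul_le_of_le_one_right (by positivity) (Real.abs_sin_le_one _)
  have h := ((hs4.hasSum.mul_left 4).sub (h3.mul_left Real.pi)).sub (hd.mul_left 4)
  have e : ∑' k : ℕ, a (2 * k + 1) * Real.sin ((2 * (k : ℝ) + 1) * Real.pi * x) = _ :=
    (tsum_congr fun k => by
      unfold a d
      push_cast
      have : (2 * (k:ℝ) + 1) ≠ 0 := by positivity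
      field_simp
      ring).trans h.tsum_eq
  unfold psi
  rw [e]
  have hpi : 24 / Real.pi ^ 4 * (Real.pi * (Real.pi ^ 3 * x * (1 - x) / 8)) = 3 * x * (1 - x) := by
    have := Real.pi_ne_zero
    field_simp
    ring
  linear_combination hm - hpi

lemma aux_Bterm (n : ℕ) (x : ℝ) :
    48 * Real.pi * x ^ 5 * (Babs (n + 1) * (2 ^ (2 * n + 1) - 1) * Real.pi ^ (2 * n) * x ^ (2 * n)
            / (((n : ℝ) + 1) * (Nat.factorial (2 * n + 5))))
      = (96 / Real.pi) * (auxGamma 4 n * x ^ (2 * n + 5)) := by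
  unfold Babs auxGamma auxBeta
  rw [show 2 * (n + 1) = 2 * n + 2 by ring, show 2 * n + 1 + 4 = 2 * n + 5 by ring,
    show Nat.factorial (2 * n + 2) = (2 * n + 2) * Nat.factorial (2 * n + 1) from rfl]
  have h1 : ((Nat.factorial (2 * n + 5) : ℕ) : ℝ) ≠ 0 := by positivity
  have h2 := Real.pi_ne_zero
  have h3 : (n:ℝ) + 1 ≠ 0 := by positivity
  push_cast
  rw [mul_pow, pow_add Real.pi, pow_add x, pow_add 2 (2 * n) 2, pow_add 2 (2 * n) 1]
  field_simp
  ring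

lemma aux_gsummable (x : ℝ) (hx : x ∈ Set.Icc (0:ℝ) (1/2)) :
    Summable (fun n : ℕ => auxGamma 4 n * x ^ (2 * n + 5)) := by
  have h := auxQ_summable 4 (z := (x:ℂ)) (by
    rw [Complex.norm_real, Real.norm_of_nonneg hx.1]; linarith [hx.2])
  have := Complex.reCLM.summable h
  refine this.congr fun n => ?_
  have e : ((auxGamma 4 n : ℝ) : ℂ) * (x:ℂ) ^ (2 * n + 1 + 4) = ((auxGamma 4 n * x ^ (2 * n + 5) : ℝ) : ℂ) := by
    push_cast; rfl
  simp only [e, Complex.reCLM_apply, Complex.ofReal_re]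

lemma aux_gamma4_le (k n : ℕ) :
    auxGamma 4 (n + (k + 1)) ≤ zetaR (2 * k + 4) / (2 * (k:ℝ) + 4) ^ 4 := by
  unfold auxGamma
  set N := n + (k + 1) with hN
  have h1 : auxBeta N ≤ zetaR (2 * k + 4) :=
    (auxBeta_le N).trans (zetaR_anti (by omega) (by omega))
  rw [div_le_div_iff₀ (by positivity) (by positivity), mul_assoc]
  refine mul_le_mul h1 ?_ (by positivity) (zetaR_nonneg _)
  have : Nat.factorial (2 * N + 1) * (2 * N + 1 + 1) ^ 4 ≤ Nat.factorial (2 * N + 1 + 4) :=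
    Nat.factorial_mul_pow_le_factorial
  have h2 : Nat.factorial (2 * N + 1) * (2 * k + 4) ^ 4 ≤ Nat.factorial (2 * N + 1 + 4) :=
    le_trans (Nat.mul_le_mul_left _ (Nat.pow_le_pow_left (by omega) _)) this
  exact_mod_cast h2

lemma aux_tail1 (k : ℕ) (x : ℝ) (hx : x ∈ Set.Icc (0:ℝ) (1/2)) :
    |(96 / Real.pi) * ∑' n : ℕ, auxGamma 4 (n + (k + 1)) * x ^ (2 * (n + (k + 1)) + 5)|
      ≤ (4 : ℝ)⁻¹ ^ k * zetaR (2 * k + 4) / (Real.pi * (2 * (k : ℝ) + 4) ^ 4) := by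
  have hpi := Real.pi_pos
  have hx0 := hx.1
  have hnn : ∀ n : ℕ, 0 ≤ auxGamma 4 (n + (k + 1)) * x ^ (2 * (n + (k + 1)) + 5) := fun n =>
    mul_nonneg (auxGamma_nonneg _ _) (by positivity)
  rw [abs_of_nonneg (mul_nonneg (by positivity) (tsum_nonneg hnn))]
  have hg := (hasSum_geometric_of_lt_one (r := (4:ℝ)⁻¹) (by norm_num) (by norm_num)).mul_left
    (zetaR (2 * k + 4) / (2 * (k:ℝ) + 4) ^ 4 * ((4:ℝ)⁻¹ ^ k * (1 / 128)))
  have hle : ∑' n : ℕ, auxGamma 4 (n + (k + 1)) * x ^ (2 * (n + (k + 1)) + 5)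
      ≤ ∑' i : ℕ, zetaR (2 * k + 4) / (2 * (k:ℝ) + 4) ^ 4 * ((4:ℝ)⁻¹ ^ k * (1 / 128)) * (4:ℝ)⁻¹ ^ i := by
    refine ((summable_nat_add_iff (k + 1)).2 (aux_gsummable x hx)).tsum_le_tsum (fun n => ?_) hg.summable
    rw [mul_assoc]
    refine mul_le_mul (aux_gamma4_le k n) ?_ (by positivity)
      (div_nonneg (zetaR_nonneg _) (by positivity))
    refine (pow_le_pow_left₀ hx0 hx.2 _).trans (le_of_eq ?_)
    rw [show 2 * (n + (k + 1)) + 5 = 2 * k + 2 * n + 7 by ring, pow_add, pow_add, pow_mul, pow_mul]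
    norm_num
    ring
  rw [hg.tsum_eq] at hle
  refine (mul_le_mul_of_nonneg_left hle (by positivity : 0 ≤ 96 / Real.pi)).trans (le_of_eq ?_)
  have : (2 * (k:ℝ) + 4) ≠ 0 := by positivity
  field_simp
  norm_num
  ring

lemma aux_exp_neg (n : ℕ) : Real.exp (-(n:ℝ)) ≤ (10 / 27) ^ n := by
  rw [show -(n:ℝ) = n * (-1) by ring, Real.exp_nat_mul]
  refine pow_le_pow_left₀ (Real.exp_pos _).le ?_ _
  rw [Real.exp_neg, inv_le_comm₀ (Real.exp_pos _) (by norm_num)]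
  have := Real.exp_one_gt_d9
  norm_num
  linarith

lemma aux_pi4 : 96 / Real.pi ^ 4 ≤ 1 - Real.exp (-(2 * Real.pi)) := by
  have h1 := Real.pi_gt_d2
  have h4 : (3.14:ℝ) ^ 4 ≤ Real.pi ^ 4 := pow_le_pow_left₀ (by norm_num) h1.le _
  have h2 : Real.exp (-(2 * Real.pi)) ≤ Real.exp (-((6:ℕ):ℝ)) := by
    apply Real.exp_le_exp.2
    push_cast
    linarith
  have h3 := h2.trans (aux_exp_neg 6)
  have h5 : 96 / Real.pi ^ 4 ≤ 96 / (3.14:ℝ) ^ 4 := by gcongr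
  norm_num at h3 h5
  linarith

lemma aux_tail2 (p : ℕ) (x : ℝ) :
    |(96 / Real.pi ^ 4) * ∑' i : ℕ, d (2 * (i + (p + 1)) + 1) / (2 * ((i + (p + 1) : ℕ) : ℝ) + 1) ^ 4
        * Real.sin ((2 * ((i + (p + 1) : ℕ) : ℝ) + 1) * Real.pi * x)|
      ≤ 2 * Real.exp (-((2 * (p:ℝ) + 3) * Real.pi)) / (2 * (p:ℝ) + 3) ^ 4 := by
  have hpi := Real.pi_pos
  set E := Real.exp (-((2 * (p:ℝ) + 3) * Real.pi)) with hE
  set r := Real.exp (-(2 * Real.pi)) with hr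
  have hr1 : r < 1 := Real.exp_lt_one_iff.2 (by linarith)
  have hr0 : 0 < r := Real.exp_pos _
  have hE0 : 0 < E := Real.exp_pos _
  have hg := (hasSum_geometric_of_lt_one hr0.le hr1).mul_left (2 * E / (2 * (p:ℝ) + 3) ^ 4)
  have hb : ∀ i : ℕ, ‖d (2 * (i + (p + 1)) + 1) / (2 * ((i + (p + 1) : ℕ) : ℝ) + 1) ^ 4
        * Real.sin ((2 * ((i + (p + 1) : ℕ) : ℝ) + 1) * Real.pi * x)‖
        ≤ 2 * E / (2 * (p:ℝ) + 3) ^ 4 * r ^ i := by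
    intro i
    rw [Real.norm_eq_abs]
    refine (aux_dterm x _).trans ?_
    have e : Real.exp (-((2 * ((i + (p + 1) : ℕ) : ℝ) + 1) * Real.pi)) = E * r ^ i := by
      rw [hE, hr, ← Real.exp_nat_mul, ← Real.exp_add]
      congr 1
      push_cast
      ring
    rw [e, show 2 * E / (2 * (p:ℝ) + 3) ^ 4 * r ^ i = 2 * (E * r ^ i) / (2 * (p:ℝ) + 3) ^ 4 by ring]
    apply div_le_div_of_nonneg_left (by positivity) (by positivity)
    apply pow_le_pow_left₀ (by positivity)
    push_cast
    linarith [(Nat.cast_nonneg i : (0:ℝ) ≤ i)]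
  have h := tsum_of_norm_bounded hg hb
  rw [Real.norm_eq_abs] at h
  rw [abs_mul, abs_of_pos (by positivity)]
  have h4 := aux_pi4
  calc _ ≤ (1 - r) * (2 * E / (2 * (p:ℝ) + 3) ^ 4 * (1 - r)⁻¹) := by
        apply mul_le_mul h4 h (abs_nonneg _) (by linarith)
    _ = _ := by
        have : 1 - r ≠ 0 := by linarith
        field_simp

lemma aux_half (k m : ℕ) (hm : Odd m) (x : ℝ) (hx : x ∈ Set.Icc (0:ℝ) (1/2)) :
    |psikm k m x - psi x| ≤
        (4 : ℝ)⁻¹ ^ k * zetaR (2 * k + 4) / (Real.pi * (2 * (k : ℝ) + 4) ^ 4)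
          + 2 * Real.exp (-(((m : ℝ) + 2) * Real.pi)) / (((m : ℝ) + 2) ^ 4) := by
  obtain ⟨p, rfl⟩ := hm
  have t1 := aux_tail1 k x hx
  have t2 := aux_tail2 p x
  have s1 := (aux_gsummable x hx).sum_add_tsum_nat_add (k + 1)
  have s2 := (aux_dsummable x).sum_add_tsum_nat_add (p + 1)
  set T1 := ∑' n : ℕ, auxGamma 4 (n + (k + 1)) * x ^ (2 * (n + (k + 1)) + 5)
  set T2 := ∑' i : ℕ, d (2 * (i + (p + 1)) + 1) / (2 * ((i + (p + 1) : ℕ) : ℝ) + 1) ^ 4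
        * Real.sin ((2 * ((i + (p + 1) : ℕ) : ℝ) + 1) * Real.pi * x)
  have e : psikm k (2 * p + 1) x - psi x = -((96 / Real.pi) * T1) + (96 / Real.pi ^ 4) * T2 := by
    rw [aux_psi x hx, ← s1, ← s2]
    unfold psikm
    rw [show (2 * p + 1 + 1) / 2 = p + 1 by omega, Finset.mul_sum (a := 48 * Real.pi * x ^ 5),
      Finset.sum_congr rfl (fun n _ => aux_Bterm n x), ← Finset.mul_sum]
    ring
  rw [e]
  refine (abs_add_le _ _).trans ?_
  rw [abs_neg]
  push_cast
  rw [show 2 * (p:ℝ) + 1 + 2 = 2 * p + 3 by ring]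
  exact add_le_add t1 t2

lemma aux_mu_lower : 0.065 ≤ mu := by
  unfold mu
  have hs : Summable (fun k : ℕ => (1 / Real.cosh ((2 * (k : ℝ) + 1) * Real.pi / 2)) ^ 2
      / (2 * (k : ℝ) + 1) ^ 4) := by
    refine Summable.of_nonneg_of_le (fun k => by positivity) (fun k => ?_)
      (auxOdd_summable (by norm_num : 2 ≤ 4))
    gcongr
    have := Real.one_le_cosh ((2 * (k : ℝ) + 1) * Real.pi / 2)
    apply pow_le_one₀ (by positivity)
    rw [div_le_one (by linarith)]
    exact this
  have h0 := hs.le_tsum 0 (fun j _ => by positivity)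
  simp only [Nat.cast_zero, mul_zero, zero_add, one_mul, one_pow, div_one] at h0
  have hpi := Real.pi_lt_d4
  have hpi0 := Real.pi_gt_d4
  have hexp : Real.exp (Real.pi / 2) ≤ 5 := by
    have h1 : Real.exp (Real.pi / 2) ≤ Real.exp (8 / 5) := Real.exp_le_exp.2 (by linarith)
    refine h1.trans ?_
    refine le_of_pow_le_pow_left₀ (n := 5) (by norm_num) (by norm_num) ?_
    rw [← Real.exp_nat_mul, show ((5:ℕ):ℝ) * (8 / 5) = ((8:ℕ):ℝ) * 1 by norm_num, Real.exp_nat_mul]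
    refine (pow_le_pow_left₀ (Real.exp_pos _).le Real.exp_one_lt_d9.le 8).trans ?_
    norm_num
  have hexp2 : Real.exp (-(Real.pi / 2)) ≤ 10 / 27 := by
    have := aux_exp_neg 1
    refine (Real.exp_le_exp.2 ?_).trans (this.trans (by norm_num))
    push_cast
    linarith
  have hc : Real.cosh (Real.pi / 2) ≤ 2.7 := by
    rw [Real.cosh_eq]; linarith
  have hc0 := Real.cosh_pos (Real.pi / 2)
  have h1 : (1 / 2.7 : ℝ) ^ 2 ≤ (1 / Real.cosh (Real.pi / 2)) ^ 2 := by gcongr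
  have h4 : Real.pi ^ 4 ≤ 3.1416 ^ 4 := pow_le_pow_left₀ (by linarith) hpi.le _
  have h5 : (48:ℝ) / 3.1416 ^ 4 ≤ 48 / Real.pi ^ 4 := by gcongr
  calc (0.065:ℝ) ≤ 48 / 3.1416 ^ 4 * (1 / 2.7 : ℝ) ^ 2 := by norm_num
    _ ≤ _ := mul_le_mul h5 (h1.trans h0) (by positivity) (by positivity)

lemma aux_symm (x : ℝ) : psi (1 - x) = psi x := by
  unfold psi
  congr 1
  refine tsum_congr fun k => ?_
  congr 1
  rw [show (2 * (k:ℝ) + 1) * Real.pi * (1 - x)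
    = Real.pi - (2 * (k:ℝ) + 1) * Real.pi * x + k * (2 * Real.pi) by ring,
    Real.sin_add_nat_mul_two_pi, Real.sin_pi_sub]

lemma aux_zeta22 : zetaR 22 ≤ 1.01 := by
  have h2 : zetaR 2 = Real.pi ^ 2 / 6 := by
    have h := hasSum_zeta_two
    have h0 := h.summable.tsum_eq_zero_add
    rw [h.tsum_eq] at h0
    rw [h0]
    unfold zetaR
    simp
  have h3 : zetaR 2 ≤ 2 := by
    rw [h2]; nlinarith [Real.pi_lt_d2, Real.pi_pos]
  have hs22 := zetaR_summable (by norm_num : 2 ≤ 22)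
  have hs2 := zetaR_summable (le_refl 2)
  have e : zetaR 22 = 1 + ∑' n : ℕ, 1 / (((n + 1 : ℕ):ℝ) + 1) ^ 22 := by
    unfold zetaR
    rw [hs22.tsum_eq_zero_add]
    simp
  have hle : ∑' n : ℕ, 1 / (((n + 1 : ℕ):ℝ) + 1) ^ 22 ≤ ∑' n : ℕ, (1 / 2 ^ 20) * (1 / ((n:ℝ) + 1) ^ 2) := by
    refine ((summable_nat_add_iff 1).2 hs22).tsum_le_tsum (fun n => ?_) (hs2.mul_left _)
    rw [div_mul_div_comm, one_mul]
    apply one_div_le_one_div_of_le (by positivity)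
    push_cast
    have hn : (0:ℝ) ≤ n := Nat.cast_nonneg n
    rw [show (22:ℕ) = 20 + 2 by norm_num, pow_add _ 20 2]
    apply mul_le_mul (pow_le_pow_left₀ (by norm_num) (by linarith) _)
      (pow_le_pow_left₀ (by linarith) (by linarith) _) (by positivity) (by positivity)
  rw [tsum_mul_left] at hle
  have : zetaR 2 = ∑' n : ℕ, 1 / ((n:ℝ) + 1) ^ 2 := rfl
  rw [← this] at hle
  rw [e]
  norm_num at hle ⊢
  linarith

lemma aux_first (k m : ℕ) (hm : Odd m) (x : ℝ) (hx : x ∈ Set.Icc (0:ℝ) 1) :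
    |phi0km k m x - phi0 x| ≤
        ((4 : ℝ)⁻¹ ^ k * zetaR (2 * k + 4) / (Real.pi * (2 * (k : ℝ) + 4) ^ 4)
          + 2 * Real.exp (-(((m : ℝ) + 2) * Real.pi)) / (((m : ℝ) + 2) ^ 4)) / mu := by
  have hmu : 0 < mu := by linarith [aux_mu_lower]
  unfold phi0km phi0
  split_ifs with h
  · rw [← sub_div, abs_div, abs_of_pos hmu]
    gcongr
    exact aux_half k m hm x ⟨hx.1, h⟩
  · rw [← aux_symm x, ← sub_div, abs_div, abs_of_pos hmu]
    gcongr
    exact aux_half k m hm (1 - x) ⟨by linarith [hx.2], by linarith⟩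

theorem phi0km_approx :
    (∀ k m : ℕ, Odd m → ∀ x ∈ Set.Icc (0:ℝ) 1,
      |phi0km k m x - phi0 x| ≤
        (4 : ℝ)⁻¹ ^ k * zetaR (2 * k + 4) / (Real.pi * mu * (2 * (k : ℝ) + 4) ^ 4)
          + 2 * Real.exp (-(((m : ℝ) + 2) * Real.pi)) / (mu * ((m : ℝ) + 2) ^ 4))
    ∧ (∀ x ∈ Set.Icc (0:ℝ) 1, |phi0km 9 5 x - phi0 x| < 1 / 10 ^ 10) := by
  have hmu : 0 < mu := by linarith [aux_mu_lower]
  have hpi := Real.pi_pos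
  refine ⟨fun k m hm x hx => (aux_first k m hm x hx).trans (le_of_eq ?_), fun x hx => ?_⟩
  · have h1 : (2 * (k:ℝ) + 4) ≠ 0 := by positivity
    have h2 : ((m:ℝ) + 2) ≠ 0 := by positivity
    field_simp
  · refine (aux_first 9 5 (by decide) x hx).trans_lt ?_
    rw [div_lt_iff₀ hmu]
    have h1 : Real.exp (-((((5:ℕ) : ℝ) + 2) * Real.pi)) ≤ (10 / 27) ^ 21 := by
      refine (Real.exp_le_exp.2 ?_).trans (aux_exp_neg 21)
      push_cast
      linarith [Real.pi_gt_three]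
    have h2 : (4 : ℝ)⁻¹ ^ 9 * zetaR (2 * 9 + 4) / (Real.pi * (2 * ((9:ℕ) : ℝ) + 4) ^ 4)
        ≤ (4 : ℝ)⁻¹ ^ 9 * 1.01 / (3.14 * (2 * ((9:ℕ) : ℝ) + 4) ^ 4) := by
      have := aux_zeta22
      have := Real.pi_gt_d2
      gcongr
    have h3 : 2 * Real.exp (-((((5:ℕ) : ℝ) + 2) * Real.pi)) / ((((5:ℕ) : ℝ) + 2) ^ 4)
        ≤ 2 * (10 / 27) ^ 21 / ((((5:ℕ) : ℝ) + 2) ^ 4) := by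
      gcongr
    refine (add_le_add h2 h3).trans_lt ?_
    refine lt_of_lt_of_le ?_ (mul_le_mul_of_nonneg_left aux_mu_lower (by norm_num))
    norm_num
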